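/- For natural numbers a > b, the quantity T(a,b) satisfies: (1) T(b+1,b) = 2^{b+1} − 1 for every b ≥ 0; (2) T(a,b) = 2^b·C(a−1,b) + T(a−1,b−1) whenever a > b > 0; (3) T(a,b) = 2^b·C(a,b) − T(a,b−1) whenever a > b > 0; (4) T(a,b) = 2^{b+1}·C(a−1,b) − T(a−1,b) whenever a > b+1; (5) T(a,b) = 2·T(a−1,b−1) + T(a−1,b) whenever a > b+1 and b > 0. -/

import Mathlib

/-- `T(a,b) = Σ_{r=0}^{b} C(a,r)·C(a−1−r, b−r)`. -/
def T (a b : ℕ) : ℕ :=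
  ∑ r ∈ Finset.range (b + 1), Nat.choose a r * Nat.choose (a - 1 - r) (b - r)

theorem sum_choose_mul_choose_sub (n k : ℕ) :
    ∑ r ∈ Finset.range (k + 1), n.choose r * (n - r).choose (k - r) = 2 ^ k * n.choose k := by
  rw [← Nat.sum_range_choose k, Finset.sum_mul]
  refine Finset.sum_congr rfl fun r hr => ?_
  have hrk : r ≤ k := Finset.mem_range_succ_iff.mp hr
  rw [mul_comm (k.choose r), Nat.choose_mul hrk]

theorem T_succ_succ (n b : ℕ) :
    T (n + 1) (b + 1) = 2 ^ (b + 1) * n.choose (b + 1) + T n b := by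
  rw [← sum_choose_mul_choose_sub n (b + 1), T, T, Finset.sum_range_succ',
    Finset.sum_range_succ' (n := b + 1), add_right_comm, ← Finset.sum_add_distrib]
  congr 1
  · refine Finset.sum_congr rfl fun r _ => ?_
    rw [Nat.choose_succ_succ, Nat.add_sub_cancel, Nat.add_sub_add_right,
      Nat.sub_sub n 1 r, Nat.add_comm 1 r]
    ring
  · simp

theorem T_succ_add_T (a b : ℕ) (h : b + 1 < a) :
    T a (b + 1) + T a b = 2 ^ (b + 1) * a.choose (b + 1) := by
  rw [← sum_choose_mul_choose_sub a (b + 1), T, T, Finset.sum_range_succ,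
    Finset.sum_range_succ (n := b + 1), add_right_comm, ← Finset.sum_add_distrib]
  congr 1
  · refine Finset.sum_congr rfl fun r hr => ?_
    have hrb : r ≤ b := Finset.mem_range_succ_iff.mp hr
    rw [← mul_add, show a - r = a - 1 - r + 1 by omega, show b + 1 - r = b - r + 1 by omega,
      Nat.choose_succ_succ, Nat.add_comm]
  · simp

theorem T_succ_self_add_one (b : ℕ) : T (b + 1) b + 1 = 2 ^ (b + 1) := by
  induction b with
  | zero => simp [T]
  | succ b ih =>
    rw [T_succ_succ (b + 1) b, Nat.choose_self, add_assoc, ih]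
    ring

/-- The quantity `T(a,b)` satisfies (subtractions are stated additively):
(1) `T(b+1,b) = 2^(b+1) − 1`;
(2) `T(a,b) = 2^b·C(a−1,b) + T(a−1,b−1)` whenever `a > b > 0`;
(3) `T(a,b) = 2^b·C(a,b) − T(a,b−1)` whenever `a > b > 0`;
(4) `T(a,b) = 2^(b+1)·C(a−1,b) − T(a−1,b)` whenever `a > b+1`;
(5) `T(a,b) = 2·T(a−1,b−1) + T(a−1,b)` whenever `a > b+1` and `b > 0`. -/
theorem T_recurrences :
    (∀ b : ℕ, T (b + 1) b + 1 = 2 ^ (b + 1)) ∧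
    (∀ a b : ℕ, b < a → 0 < b →
      T a b = 2 ^ b * Nat.choose (a - 1) b + T (a - 1) (b - 1)) ∧
    (∀ a b : ℕ, b < a → 0 < b →
      T a b + T a (b - 1) = 2 ^ b * Nat.choose a b) ∧
    (∀ a b : ℕ, b + 1 < a →
      T a b + T (a - 1) b = 2 ^ (b + 1) * Nat.choose (a - 1) b) ∧
    (∀ a b : ℕ, b + 1 < a → 0 < b →
      T a b = 2 * T (a - 1) (b - 1) + T (a - 1) b) := by
  refine ⟨T_succ_self_add_one, ?_, ?_, ?_, ?_⟩
  · rintro (_ | n) (_ | b) h hb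
    · omega
    · omega
    · omega
    · exact T_succ_succ n b
  · rintro a (_ | b) h hb
    · omega
    · exact T_succ_add_T a b h
  · rintro (_ | n) b h
    · omega
    · have h₂ := T_succ_succ n b
      have h₃ := T_succ_add_T (n + 1) b h
      rw [Nat.choose_succ_succ, mul_add] at h₃
      simp only [Nat.add_sub_cancel, Nat.succ_eq_add_one] at *
      omega
  · rintro (_ | n) (_ | b) h hb
    · omega
    · omega
    · omega
    · have h₂ := T_succ_succ n b
      have h₃ := T_succ_add_T n b (by omega)
      simp only [Nat.add_sub_cancel]
      omega
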